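/- The Fourier projection F_n is minimal in 𝒫(C(2π), Π_n) with respect to numerical radius: ‖F_n‖_w ≤ ‖P‖_w for every projection P ∈ 𝒫(C(2π), Π_n). -/

import Mathlib

open MeasureTheory
open scoped Real ENNReal

instance : Fact (0 < 2 * π) := ⟨by positivity⟩

/-- `C(2π)`: continuous `2π`-periodic real-valued functions with the sup norm. -/
abbrev C2pi : Type := C(AddCircle (2 * π), ℝ)

/-- `cos (k t)` as an element of `C(2π)`. -/
noncomputable def cosF (k : ℕ) : C2pi :=
  ⟨fun t => (fourier (T := 2 * π) k t).re, (Complex.continuous_re.comp (map_continuous _))⟩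

/-- `sin (k t)` as an element of `C(2π)`. -/
noncomputable def sinF (k : ℕ) : C2pi :=
  ⟨fun t => (fourier (T := 2 * π) k t).im, (Complex.continuous_im.comp (map_continuous _))⟩

/-- `Π_n`: the space of trigonometric polynomials of degree at most `n`. -/
noncomputable def trigPoly (n : ℕ) : Submodule ℝ C2pi :=
  Submodule.span ℝ {f : C2pi | ∃ k : ℕ, k ≤ n ∧ (f = cosF k ∨ f = sinF k)}

/-- The `L²`-inner-product coefficient functional `f ↦ ∫₀^{2π} f(t) g(t) dt`. -/
noncomputable def coeffCLM (g : C2pi) : C2pi →L[ℝ] ℝ :=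
  (innerSL ℝ (ContinuousMap.toLp (E := ℝ) 2 volume ℝ g)).comp
    (ContinuousMap.toLp (E := ℝ) 2 volume ℝ)

/-- The Fourier projection `F_n : C(2π) → Π_n`, sending `f` to its `n`-th Fourier
partial sum. -/
noncomputable def fourierProj (n : ℕ) : C2pi →L[ℝ] C2pi :=
  (1 / (2 * π)) • (coeffCLM (cosF 0)).smulRight (cosF 0) +
    ∑ k ∈ Finset.Icc 1 n,
      ((1 / π) • ((coeffCLM (cosF k)).smulRight (cosF k) +
        (coeffCLM (sinF k)).smulRight (sinF k)))

/-- Translation operator `(T_g f)(t) = f(t + g)` on `C(2π)`. -/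
noncomputable def translateBy (g : ℝ) (f : C2pi) : C2pi :=
  f.comp ⟨fun t => t + (g : AddCircle (2 * π)), by continuity⟩

/-- The numerical radius of a bounded linear operator `S` on a normed space `X`:
`‖S‖_w = sup {|x*(Sx)| : ‖x‖ = ‖x*‖ = 1, x*(x) = 1}`. -/
noncomputable def numericalRadius (X : Type*) [NormedAddCommGroup X]
    [NormedSpace ℝ X] (S : X →L[ℝ] X) : ℝ :=
  sSup {r : ℝ | ∃ (x : X) (f : X →L[ℝ] ℝ), ‖x‖ = 1 ∧ ‖f‖ = 1 ∧ f x = 1 ∧ r = ‖f (S x)‖}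

theorem cosF_apply (k : ℕ) (t : AddCircle (2 * π)) :
    cosF k t = (fourier (k : ℤ) t).re := rfl

theorem sinF_apply (k : ℕ) (t : AddCircle (2 * π)) :
    sinF k t = (fourier (k : ℤ) t).im := rfl

theorem integral_fourier (m : ℤ) :
    ∫ t : AddCircle (2 * π), fourier m t = if m = 0 then ((2 * π : ℝ) : ℂ) else 0 := by
  split_ifs with hm
  · subst hm
    simp [Measure.real, AddCircle.measure_univ, Real.pi_pos.le]
  · exact integral_eq_zero_of_add_right_eq_neg
      (fourier_add_half_inv_index hm Real.two_pi_pos)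

theorem integrable_continuousMap {E : Type*} [NormedAddCommGroup E] (f : C(AddCircle (2 * π), E)) :
    Integrable (fun t => f t) volume :=
  f.continuous.integrable_of_hasCompactSupport (HasCompactSupport.of_compactSpace _)

theorem integral_re_fourier (m : ℤ) :
    ∫ t : AddCircle (2 * π), (fourier m t).re = if m = 0 then 2 * π else 0 := by
  have h := integral_re (𝕜 := ℂ) (integrable_continuousMap (fourier m))
  simp only [RCLike.re_to_complex] at h
  rw [h, integral_fourier]
  split_ifs <;> simp

theorem integral_im_fourier (m : ℤ) :
    ∫ t : AddCircle (2 * π), (fourier m t).im = 0 := by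
  have h := integral_im (𝕜 := ℂ) (integrable_continuousMap (fourier m))
  simp only [RCLike.im_to_complex] at h
  rw [h, integral_fourier]
  split_ifs <;> simp

theorem fourier_sub {m n : ℤ} {x : AddCircle (2 * π)} :
    fourier (m - n) x = fourier m x * (starRingEnd ℂ) (fourier n x) := by
  rw [sub_eq_add_neg, fourier_add, fourier_neg]

theorem integrable_re_fourier (m : ℤ) :
    Integrable (fun t : AddCircle (2 * π) => (fourier m t).re) volume :=
  (integrable_continuousMap (fourier m)).re

theorem integrable_im_fourier (m : ℤ) :
    Integrable (fun t : AddCircle (2 * π) => (fourier m t).im) volume :=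
  (integrable_continuousMap (fourier m)).im

theorem coeffCLM_apply (g f : C2pi) : coeffCLM g f = ∫ t, g t * f t := by
  unfold coeffCLM
  simp [ContinuousMap.inner_toLp, mul_comm]

theorem integral_cosF_mul_cosF (j k : ℕ) :
    ∫ t, cosF j t * cosF k t = if j = k then (if k = 0 then 2 * π else π) else 0 := by
  have h : ∀ t, cosF j t * cosF k t =
      (1 / 2) * ((fourier (j - k : ℤ) t).re + (fourier (j + k : ℤ) t).re) := fun t => by
    simp only [cosF_apply, fourier_sub, fourier_add, Complex.mul_re, Complex.conj_re,
      Complex.conj_im]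
    ring
  simp only [h]
  rw [integral_const_mul, integral_add (integrable_re_fourier _) (integrable_re_fourier _),
    integral_re_fourier, integral_re_fourier]
  split_ifs <;> first | omega | ring

theorem integral_sinF_mul_sinF (j k : ℕ) :
    ∫ t, sinF j t * sinF k t = if j = k then (if k = 0 then 0 else π) else 0 := by
  have h : ∀ t, sinF j t * sinF k t =
      (1 / 2) * ((fourier (j - k : ℤ) t).re - (fourier (j + k : ℤ) t).re) := fun t => by
    simp only [sinF_apply, fourier_sub, fourier_add, Complex.mul_re, Complex.conj_re,
      Complex.conj_im]
    ring
  simp only [h]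
  rw [integral_const_mul, integral_sub (integrable_re_fourier _) (integrable_re_fourier _),
    integral_re_fourier, integral_re_fourier]
  split_ifs <;> first | omega | ring

theorem integral_sinF_mul_cosF (j k : ℕ) : ∫ t, sinF j t * cosF k t = 0 := by
  have h : ∀ t, sinF j t * cosF k t =
      (1 / 2) * ((fourier (j - k : ℤ) t).im + (fourier (j + k : ℤ) t).im) := fun t => by
    simp only [sinF_apply, cosF_apply, fourier_sub, fourier_add, Complex.mul_im, Complex.conj_re,
      Complex.conj_im]
    ring
  simp only [h]
  rw [integral_const_mul, integral_add (integrable_im_fourier _) (integrable_im_fourier _),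
    integral_im_fourier, integral_im_fourier]
  simp

theorem integral_cosF_mul_sinF (j k : ℕ) : ∫ t, cosF j t * sinF k t = 0 := by
  simpa only [mul_comm] using integral_sinF_mul_cosF k j

theorem sinF_zero : sinF 0 = 0 := by
  ext t
  simp [sinF_apply]

theorem fourierProj_apply (n : ℕ) (f : C2pi) :
    fourierProj n f = (1 / (2 * π)) • (coeffCLM (cosF 0) f • cosF 0) +
      ∑ k ∈ Finset.Icc 1 n,
        (1 / π) • (coeffCLM (cosF k) f • cosF k + coeffCLM (sinF k) f • sinF k) := by
  simp [fourierProj]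

theorem fourierProj_cosF (n k : ℕ) :
    fourierProj n (cosF k) = if k ≤ n then cosF k else 0 := by
  have hπ := Real.pi_ne_zero
  simp only [fourierProj_apply, coeffCLM_apply, integral_cosF_mul_cosF, integral_sinF_mul_cosF,
    zero_smul, add_zero, ite_smul, smul_ite, smul_zero, smul_smul, Finset.sum_ite_eq',
    Finset.mem_Icc]
  rcases Nat.eq_zero_or_pos k with rfl | hk
  · rw [if_pos rfl, if_pos rfl, if_neg (by simp), if_pos n.zero_le, add_zero,
      one_div_mul_cancel (by positivity), one_smul]
  · simp [hk.ne, hk.ne', Nat.one_le_iff_ne_zero, hπ]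

theorem fourierProj_sinF (n k : ℕ) :
    fourierProj n (sinF k) = if k ≤ n then sinF k else 0 := by
  have hπ := Real.pi_ne_zero
  rcases Nat.eq_zero_or_pos k with rfl | hk
  · simp [sinF_zero]
  simp only [fourierProj_apply, coeffCLM_apply, integral_sinF_mul_sinF, integral_cosF_mul_sinF,
    zero_smul, zero_add, ite_smul, smul_ite, smul_zero, smul_smul, Finset.sum_ite_eq',
    Finset.mem_Icc]
  simp [hk.ne', Nat.one_le_iff_ne_zero, hπ]

/-- Translation `f ↦ f (· + g)` as a continuous linear map on `C(2π)`. -/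
noncomputable def translateCLM (g : AddCircle (2 * π)) : C2pi →L[ℝ] C2pi where
  toFun f := f.comp (ContinuousMap.addRight g)
  map_add' _ _ := rfl
  map_smul' _ _ := rfl
  cont := ContinuousMap.continuous_precomp _

theorem translateCLM_apply (g : AddCircle (2 * π)) (f : C2pi) (t : AddCircle (2 * π)) :
    translateCLM g f t = f (t + g) := rfl

theorem norm_translateCLM_apply_le (g : AddCircle (2 * π)) (f : C2pi) :
    ‖translateCLM g f‖ ≤ ‖f‖ :=
  (ContinuousMap.norm_le _ (norm_nonneg _)).2 fun t => f.norm_coe_le_norm (t + g)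

theorem translateCLM_neg_translateCLM (g : AddCircle (2 * π)) (f : C2pi) :
    translateCLM (-g) (translateCLM g f) = f := by
  ext t
  simp [translateCLM_apply]

theorem continuous_translateCLM :
    Continuous fun p : AddCircle (2 * π) × C2pi => translateCLM p.1 p.2 := by
  have h : Continuous fun g : AddCircle (2 * π) => ContinuousMap.addRight g :=
    ContinuousMap.continuous_of_continuous_uncurry _ (by
      simp only [Function.uncurry_def, ContinuousMap.coe_addRight]; fun_prop)
  exact continuous_snd.compCM (h.comp continuous_fst)

theorem fourier_apply_add (k : ℤ) (s t : AddCircle (2 * π)) :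
    fourier k (s + t) = fourier k s * fourier k t := by
  simp [fourier_apply, AddCircle.toCircle_add]

theorem fourier_apply_neg (k : ℤ) (t : AddCircle (2 * π)) :
    fourier k (-t) = (starRingEnd ℂ) (fourier k t) := by
  rw [← fourier_neg, fourier_apply, fourier_apply, smul_neg, neg_smul]

theorem cosF_neg (k : ℕ) (t : AddCircle (2 * π)) : cosF k (-t) = cosF k t := by
  simp only [cosF_apply, fourier_apply_neg, Complex.conj_re]

theorem sinF_neg (k : ℕ) (t : AddCircle (2 * π)) : sinF k (-t) = -sinF k t := by
  simp only [sinF_apply, fourier_apply_neg, Complex.conj_im]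

theorem translateCLM_cosF (g : AddCircle (2 * π)) (k : ℕ) :
    translateCLM g (cosF k) = cosF k g • cosF k - sinF k g • sinF k := by
  ext t
  simp only [translateCLM_apply, cosF_apply, sinF_apply, ContinuousMap.sub_apply,
    ContinuousMap.smul_apply, smul_eq_mul, fourier_apply_add, Complex.mul_re]
  ring

theorem translateCLM_sinF (g : AddCircle (2 * π)) (k : ℕ) :
    translateCLM g (sinF k) = sinF k g • cosF k + cosF k g • sinF k := by
  ext t
  simp only [translateCLM_apply, cosF_apply, sinF_apply, ContinuousMap.add_apply,
    ContinuousMap.smul_apply, smul_eq_mul, fourier_apply_add, Complex.mul_im]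
  ring

theorem cosF_mem_trigPoly {n k : ℕ} (hk : k ≤ n) : cosF k ∈ trigPoly n :=
  Submodule.subset_span ⟨k, hk, Or.inl rfl⟩

theorem sinF_mem_trigPoly {n k : ℕ} (hk : k ≤ n) : sinF k ∈ trigPoly n :=
  Submodule.subset_span ⟨k, hk, Or.inr rfl⟩

theorem translateCLM_mem_trigPoly {n : ℕ} (g : AddCircle (2 * π)) {f : C2pi}
    (hf : f ∈ trigPoly n) : translateCLM g f ∈ trigPoly n := by
  induction hf using Submodule.span_induction with
  | mem f hf =>
    obtain ⟨k, hk, rfl | rfl⟩ := hf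
    · rw [translateCLM_cosF]
      exact sub_mem (Submodule.smul_mem _ _ (cosF_mem_trigPoly hk))
        (Submodule.smul_mem _ _ (sinF_mem_trigPoly hk))
    · rw [translateCLM_sinF]
      exact add_mem (Submodule.smul_mem _ _ (cosF_mem_trigPoly hk))
        (Submodule.smul_mem _ _ (sinF_mem_trigPoly hk))
  | zero => simp
  | add f₁ f₂ _ _ h₁ h₂ => rw [map_add]; exact add_mem h₁ h₂
  | smul c f _ h => rw [map_smul]; exact Submodule.smul_mem _ _ h

/-- The real trigonometric system. -/
def trigSystem : Set C2pi := Set.range cosF ∪ Set.range sinF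

theorem exists_re_im_fourier (m : ℤ) : ∃ k : ℕ, ∃ c : ℝ, ∀ t : AddCircle (2 * π),
    (fourier m t).re = cosF k t ∧ (fourier m t).im = c * sinF k t := by
  obtain ⟨k, rfl | rfl⟩ := m.eq_nat_or_neg
  · exact ⟨k, 1, fun t => ⟨rfl, (one_mul _).symm⟩⟩
  · refine ⟨k, -1, fun t => ?_⟩
    rw [fourier_neg, Complex.conj_re, Complex.conj_im, neg_one_mul]
    exact ⟨rfl, rfl⟩

theorem dense_span_trigSystem : Dense (Submodule.span ℝ trigSystem : Set C2pi) := by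
  let re : C(AddCircle (2 * π), ℂ) → C2pi := fun f =>
    (⟨Complex.re, Complex.continuous_re⟩ : C(ℂ, ℝ)).comp f
  have re_cont : Continuous re := ContinuousMap.continuous_postcomp _
  have re_surj : Function.Surjective re := fun f =>
    ⟨(⟨Complex.ofReal, Complex.continuous_ofReal⟩ : C(ℝ, ℂ)).comp f, by ext t; simp [re]⟩
  have hd : Dense (Submodule.span ℂ (Set.range (fourier (T := 2 * π))) :
      Set C(AddCircle (2 * π), ℂ)) :=
    Submodule.dense_iff_topologicalClosure_eq_top.2 span_fourier_closure_eq_top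
  refine (re_surj.denseRange.dense_image re_cont hd).mono ?_
  rintro _ ⟨p, hp, rfl⟩
  obtain ⟨c, rfl⟩ := Finsupp.mem_span_range_iff_exists_finsupp.1 hp
  have hre : re (c.sum fun m a => a • fourier m) = c.sum fun m a => re (a • fourier m) := by
    ext t
    simp [re, Finsupp.sum, ContinuousMap.sum_apply]
  rw [hre]
  refine Submodule.sum_mem _ fun m _ => ?_
  obtain ⟨k, s, hk⟩ := exists_re_im_fourier m
  have hterm : re (c m • fourier m) = (c m).re • cosF k - ((c m).im * s) • sinF k := by
    ext t
    change (c m * fourier m t).re = (c m).re * cosF k t - (c m).im * s * sinF k t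
    rw [Complex.mul_re, (hk t).1, (hk t).2, mul_assoc]
  simp only [hterm]
  exact sub_mem (Submodule.smul_mem _ _ (Submodule.subset_span (Or.inl ⟨k, rfl⟩)))
    (Submodule.smul_mem _ _ (Submodule.subset_span (Or.inr ⟨k, rfl⟩)))

theorem measureReal_addCircle_univ :
    (volume : Measure (AddCircle (2 * π))).real Set.univ = 2 * π := by
  simp [Measure.real, AddCircle.measure_univ, Real.pi_pos.le]

theorem norm_integral_addCircle_le {f : AddCircle (2 * π) → ℝ} {C : ℝ} (h : ∀ t, ‖f t‖ ≤ C) :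
    ‖∫ t, f t‖ ≤ C * (2 * π) :=
  (norm_integral_le_of_norm_le_const (.of_forall h)).trans_eq
    (congrArg (C * ·) measureReal_addCircle_univ)

theorem continuous_conj_translateCLM (P : C2pi →L[ℝ] C2pi) (φ : C2pi →L[ℝ] ℝ) (x : C2pi) :
    Continuous fun g => φ (translateCLM (-g) (P (translateCLM g x))) := by
  have h : Continuous fun g : AddCircle (2 * π) => translateCLM g x :=
    continuous_translateCLM.comp (continuous_id.prodMk continuous_const)
  exact φ.continuous.comp
    (continuous_translateCLM.comp (continuous_neg.prodMk (P.continuous.comp h)))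

theorem integrable_conj_translateCLM (P : C2pi →L[ℝ] C2pi) (φ : C2pi →L[ℝ] ℝ) (x : C2pi) :
    Integrable (fun g => φ (translateCLM (-g) (P (translateCLM g x)))) volume :=
  integrable_continuousMap ⟨_, continuous_conj_translateCLM P φ x⟩

/-- The functional `x ↦ ∫ φ (T_{-g} P T_g x) dg`. -/
noncomputable def averageCLM (P : C2pi →L[ℝ] C2pi) (φ : C2pi →L[ℝ] ℝ) : C2pi →L[ℝ] ℝ :=
  LinearMap.mkContinuous
    { toFun := fun x => ∫ g, φ (translateCLM (-g) (P (translateCLM g x)))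
      map_add' := fun x y => by
        simp only [map_add]
        exact integral_add (integrable_conj_translateCLM P φ x) (integrable_conj_translateCLM P φ y)
      map_smul' := fun c x => by
        simp only [map_smul, RingHom.id_apply]
        exact integral_smul c _ }
    (‖φ‖ * ‖P‖ * (2 * π)) fun x => by
      rw [mul_right_comm]
      refine norm_integral_addCircle_le fun g => ?_
      calc ‖φ (translateCLM (-g) (P (translateCLM g x)))‖
          ≤ ‖φ‖ * ‖translateCLM (-g) (P (translateCLM g x))‖ := φ.le_opNorm _
        _ ≤ ‖φ‖ * (‖P‖ * ‖x‖) := by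
          gcongr
          exact (norm_translateCLM_apply_le _ _).trans
            (P.le_opNorm_of_le (norm_translateCLM_apply_le _ _))
        _ = ‖φ‖ * ‖P‖ * ‖x‖ := (mul_assoc _ _ _).symm

theorem averageCLM_apply (P : C2pi →L[ℝ] C2pi) (φ : C2pi →L[ℝ] ℝ) (x : C2pi) :
    averageCLM P φ x = ∫ g, φ (translateCLM (-g) (P (translateCLM g x))) := rfl

theorem integrable_mul (f g : C2pi) : Integrable (fun t => f t * g t) volume :=
  integrable_continuousMap (f * g)

theorem integrable_mul_translateCLM_neg (h : C2pi) (φ : C2pi →L[ℝ] ℝ) (u : C2pi) :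
    Integrable (fun g => h g * φ (translateCLM (-g) u)) volume := by
  have hc : Continuous fun g : AddCircle (2 * π) => translateCLM (-g) u :=
    continuous_translateCLM.comp (continuous_neg.prodMk continuous_const)
  exact integrable_continuousMap ⟨_, h.continuous.mul (φ.continuous.comp hc)⟩

theorem integral_mul_translateCLM_neg_eq_zero {n : ℕ} {h : C2pi}
    (hcos : ∀ j ≤ n, ∫ t, h t * cosF j t = 0) (hsin : ∀ j ≤ n, ∫ t, h t * sinF j t = 0)
    (φ : C2pi →L[ℝ] ℝ) {u : C2pi} (hu : u ∈ trigPoly n) :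
    ∫ g, h g * φ (translateCLM (-g) u) = 0 := by
  induction hu using Submodule.span_induction with
  | mem u hu =>
    obtain ⟨j, hj, rfl | rfl⟩ := hu
    · have key : ∀ g, h g * φ (translateCLM (-g) (cosF j)) =
          h g * cosF j g * φ (cosF j) + h g * sinF j g * φ (sinF j) := fun g => by
        simp only [translateCLM_cosF, cosF_neg, sinF_neg, map_sub, map_smul, smul_eq_mul]
        ring
      simp only [key]
      rw [integral_add ((integrable_mul h (cosF j)).mul_const _)
          ((integrable_mul h (sinF j)).mul_const _),
        integral_mul_const, integral_mul_const, hcos j hj, hsin j hj]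
      simp
    · have key : ∀ g, h g * φ (translateCLM (-g) (sinF j)) =
          h g * cosF j g * φ (sinF j) - h g * sinF j g * φ (cosF j) := fun g => by
        simp only [translateCLM_sinF, cosF_neg, sinF_neg, map_add, map_smul, smul_eq_mul]
        ring
      simp only [key]
      rw [integral_sub ((integrable_mul h (cosF j)).mul_const _)
          ((integrable_mul h (sinF j)).mul_const _),
        integral_mul_const, integral_mul_const, hcos j hj, hsin j hj]
      simp
  | zero => simp
  | add u v _ _ hu hv =>
    simp only [map_add, mul_add]
    rw [integral_add (integrable_mul_translateCLM_neg h φ u)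
      (integrable_mul_translateCLM_neg h φ v), hu, hv, add_zero]
  | smul c u _ hu =>
    simp only [map_smul, smul_eq_mul, mul_left_comm _ c]
    rw [integral_const_mul, hu, mul_zero]

theorem integral_cosF_mul_translateCLM_neg {n k : ℕ} (hk : n < k) (φ : C2pi →L[ℝ] ℝ) {u : C2pi}
    (hu : u ∈ trigPoly n) : ∫ g, cosF k g * φ (translateCLM (-g) u) = 0 :=
  integral_mul_translateCLM_neg_eq_zero
    (fun j hj => by rw [integral_cosF_mul_cosF, if_neg (by omega)])
    (fun j _ => integral_cosF_mul_sinF k j) φ hu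

theorem integral_sinF_mul_translateCLM_neg {n k : ℕ} (hk : n < k) (φ : C2pi →L[ℝ] ℝ) {u : C2pi}
    (hu : u ∈ trigPoly n) : ∫ g, sinF k g * φ (translateCLM (-g) u) = 0 :=
  integral_mul_translateCLM_neg_eq_zero (fun j _ => integral_sinF_mul_cosF k j)
    (fun j hj => by rw [integral_sinF_mul_sinF, if_neg (by omega)]) φ hu

section Averaging

variable {n : ℕ} {P : C2pi →L[ℝ] C2pi}

theorem averageCLM_apply_of_mem (hPproj : ∀ f ∈ trigPoly n, P f = f) (φ : C2pi →L[ℝ] ℝ)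
    {x : C2pi} (hx : x ∈ trigPoly n) : averageCLM P φ x = 2 * π * φ x := by
  simp only [averageCLM_apply, hPproj _ (translateCLM_mem_trigPoly _ hx),
    translateCLM_neg_translateCLM, integral_const, measureReal_addCircle_univ, smul_eq_mul]

theorem averageCLM_cosF_of_lt (hPrange : ∀ f : C2pi, P f ∈ trigPoly n) (φ : C2pi →L[ℝ] ℝ)
    {k : ℕ} (hk : n < k) : averageCLM P φ (cosF k) = 0 := by
  simp only [averageCLM_apply, translateCLM_cosF, map_sub, map_smul, smul_eq_mul]
  rw [integral_sub (integrable_mul_translateCLM_neg _ _ _) (integrable_mul_translateCLM_neg _ _ _),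
    integral_cosF_mul_translateCLM_neg hk φ (hPrange _),
    integral_sinF_mul_translateCLM_neg hk φ (hPrange _), sub_zero]

theorem averageCLM_sinF_of_lt (hPrange : ∀ f : C2pi, P f ∈ trigPoly n) (φ : C2pi →L[ℝ] ℝ)
    {k : ℕ} (hk : n < k) : averageCLM P φ (sinF k) = 0 := by
  simp only [averageCLM_apply, translateCLM_sinF, map_add, map_smul, smul_eq_mul]
  rw [integral_add (integrable_mul_translateCLM_neg _ _ _) (integrable_mul_translateCLM_neg _ _ _),
    integral_cosF_mul_translateCLM_neg hk φ (hPrange _),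
    integral_sinF_mul_translateCLM_neg hk φ (hPrange _), add_zero]

/-- Averaging a projection onto `Π_n` over all translations gives the Fourier projection. -/
theorem averageCLM_eq (hPrange : ∀ f : C2pi, P f ∈ trigPoly n)
    (hPproj : ∀ f ∈ trigPoly n, P f = f) (φ : C2pi →L[ℝ] ℝ) :
    averageCLM P φ = (2 * π) • φ.comp (fourierProj n) := by
  refine ContinuousLinearMap.ext_on dense_span_trigSystem ?_
  rintro _ (⟨k, rfl⟩ | ⟨k, rfl⟩) <;>
    rw [smul_apply, ContinuousLinearMap.comp_apply, smul_eq_mul] <;>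
    rcases le_or_gt k n with hk | hk
  · rw [fourierProj_cosF, if_pos hk, averageCLM_apply_of_mem hPproj φ (cosF_mem_trigPoly hk)]
  · rw [fourierProj_cosF, if_neg hk.not_ge, averageCLM_cosF_of_lt hPrange φ hk, map_zero, mul_zero]
  · rw [fourierProj_sinF, if_pos hk, averageCLM_apply_of_mem hPproj φ (sinF_mem_trigPoly hk)]
  · rw [fourierProj_sinF, if_neg hk.not_ge, averageCLM_sinF_of_lt hPrange φ hk, map_zero, mul_zero]

end Averaging

theorem norm_apply_le_numericalRadius {X : Type*} [NormedAddCommGroup X] [NormedSpace ℝ X]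
    (S : X →L[ℝ] X) {x : X} {φ : X →L[ℝ] ℝ} (hx : ‖x‖ = 1) (hφ : ‖φ‖ = 1) (hφx : φ x = 1) :
    ‖φ (S x)‖ ≤ numericalRadius X S := by
  refine le_csSup ⟨‖S‖, ?_⟩ ⟨x, φ, hx, hφ, hφx, rfl⟩
  rintro _ ⟨y, ψ, hy, hψ, -, rfl⟩
  calc ‖ψ (S y)‖ ≤ ‖ψ‖ * (‖S‖ * ‖y‖) := ψ.le_opNorm_of_le (S.le_opNorm y)
    _ = ‖S‖ := by rw [hy, hψ, one_mul, mul_one]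

theorem numericalRadius_nonneg {X : Type*} [NormedAddCommGroup X] [NormedSpace ℝ X]
    (S : X →L[ℝ] X) : 0 ≤ numericalRadius X S := by
  refine Real.sSup_nonneg ?_
  rintro _ ⟨x, φ, -, -, -, rfl⟩
  exact norm_nonneg _

theorem norm_conj_translateCLM_le_numericalRadius (P : C2pi →L[ℝ] C2pi) {x : C2pi}
    {φ : C2pi →L[ℝ] ℝ} (hx : ‖x‖ = 1) (hφ : ‖φ‖ = 1) (hφx : φ x = 1) (g : AddCircle (2 * π)) :
    ‖φ (translateCLM (-g) (P (translateCLM g x)))‖ ≤ numericalRadius C2pi P := by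
  have hval : φ.comp (translateCLM (-g)) (translateCLM g x) = 1 := by
    rw [ContinuousLinearMap.comp_apply, translateCLM_neg_translateCLM, hφx]
  have hx_le : ‖translateCLM g x‖ ≤ 1 := (norm_translateCLM_apply_le g x).trans hx.le
  have hφ_le : ‖φ.comp (translateCLM (-g))‖ ≤ 1 :=
    ContinuousLinearMap.opNorm_le_bound _ zero_le_one fun y => by
      simpa [hφ] using φ.le_opNorm_of_le (norm_translateCLM_apply_le (-g) y)
  have hone : 1 ≤ ‖φ.comp (translateCLM (-g))‖ * ‖translateCLM g x‖ := by
    simpa [hval] using (φ.comp (translateCLM (-g))).le_opNorm (translateCLM g x)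
  refine norm_apply_le_numericalRadius P (φ := φ.comp (translateCLM (-g)))
    (le_antisymm hx_le ?_) (le_antisymm hφ_le ?_) hval
  · exact hone.trans (mul_le_of_le_one_left (norm_nonneg _) hφ_le)
  · exact hone.trans (mul_le_of_le_one_right (ContinuousLinearMap.opNorm_nonneg _) hx_le)

/-- The Fourier projection `F_n` is a minimal projection of `C(2π)` onto `Π_n` with
respect to the numerical radius. -/
theorem fourierProj_minimal_numericalRadius (n : ℕ) (P : C2pi →L[ℝ] C2pi)
    (hPrange : ∀ f : C2pi, P f ∈ trigPoly n)
    (hPproj : ∀ f ∈ trigPoly n, P f = f) :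
    numericalRadius C2pi (fourierProj n) ≤ numericalRadius C2pi P := by
  refine Real.sSup_le ?_ (numericalRadius_nonneg P)
  rintro _ ⟨x, φ, hx, hφ, hφx, rfl⟩
  have havg : averageCLM P φ x = 2 * π * φ (fourierProj n x) := by
    rw [averageCLM_eq hPrange hPproj]
    rfl
  have hle : ‖averageCLM P φ x‖ ≤ numericalRadius C2pi P * (2 * π) :=
    norm_integral_addCircle_le (norm_conj_translateCLM_le_numericalRadius P hx hφ hφx)
  rw [havg, norm_mul, Real.norm_of_nonneg Real.two_pi_pos.le, mul_comm] at hle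
  exact le_of_mul_le_mul_right hle Real.two_pi_pos
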